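/- Let X be a standard Gaussian random variable and let Y = H₅(X) = X⁵ − 10X³ + 15X. Define the operator S₅ f(y) = y f(y) − 120 f'(y) − 75325y f''(y) + (−81875y² + 7704000) f^{(3)}(y) + (−31250y³ + 270600000y) f^{(4)}(y) + (−3125y⁴ + 527800000y² − 39086400000) f^{(5)}(y) + (280000000y³ − 155065000000y) f^{(6)}(y) + (35000000y⁴ − 241335000000y² + 14306880000000) f^{(7)}(y) + (−198750000000y³ + 53403600000000y) f^{(8)}(y) + (−33125000000y⁴ + 34950000000000y² − 1170432000000000) f^{(9)}(y) + (39000000000000y³ − 10843200000000000y) f^{(10)}(y) + (9750000000000y⁴ − 6696000000000000y² + 352512000000000000) f^{(11)}(y) + (−2160000000000000y³ + 622080000000000000y) f^{(12)}(y) + (−1080000000000000y⁴ + 622080000000000000y² − 29859840000000000000) f^{(13)}(y). Let W be a symmetric real-valued random variable (W and −W are equal in law) with E[W⁴] < ∞. Then W is equal in law to H₅(X) if and only if E[S₅ f(W)] = 0 for all f ∈ F_{S₅,Y}. -/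

import Mathlib

open MeasureTheory ProbabilityTheory Filter Set
open scoped Topology

/-- The standard Gaussian distribution, with density `(2π)^(-1/2) exp(-x²/2)` on `ℝ`. -/
noncomputable def stdGaussian : Measure ℝ :=
  volume.withDensity fun x =>
    ENNReal.ofReal ((Real.sqrt (2 * Real.pi))⁻¹ * Real.exp (-x ^ 2 / 2))

/-- The law of `H₅(X) = X⁵ - 10X³ + 15X` for `X` standard Gaussian. -/
noncomputable def lawH5 : Measure ℝ :=
  Measure.map (fun x : ℝ => x ^ 5 - 10 * x ^ 3 + 15 * x) stdGaussian

/-- The Stein operator `S₅` for `H₅(X)` with coefficients of minimal polynomial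
degree (`T = 13`, `m = 4`). -/
noncomputable def steinH5 (f : ℝ → ℝ) (y : ℝ) : ℝ :=
  y * f y - 120 * deriv f y - 75325 * y * iteratedDeriv 2 f y
    + (-81875 * y ^ 2 + 7704000) * iteratedDeriv 3 f y
    + (-31250 * y ^ 3 + 270600000 * y) * iteratedDeriv 4 f y
    + (-3125 * y ^ 4 + 527800000 * y ^ 2 - 39086400000) * iteratedDeriv 5 f y
    + (280000000 * y ^ 3 - 155065000000 * y) * iteratedDeriv 6 f y
    + (35000000 * y ^ 4 - 241335000000 * y ^ 2 + 14306880000000) * iteratedDeriv 7 f y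
    + (-198750000000 * y ^ 3 + 53403600000000 * y) * iteratedDeriv 8 f y
    + (-33125000000 * y ^ 4 + 34950000000000 * y ^ 2 - 1170432000000000) *
        iteratedDeriv 9 f y
    + (39000000000000 * y ^ 3 - 10843200000000000 * y) * iteratedDeriv 10 f y
    + (9750000000000 * y ^ 4 - 6696000000000000 * y ^ 2 + 352512000000000000) *
        iteratedDeriv 11 f y
    + (-2160000000000000 * y ^ 3 + 622080000000000000 * y) * iteratedDeriv 12 f y
    + (-1080000000000000 * y ^ 4 + 622080000000000000 * y ^ 2 - 29859840000000000000) *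
        iteratedDeriv 13 f y

/-- Membership in the class `F_{S₅,Y}` (here `T = 13`, `m = 4`, `I = ℝ`). -/
def memFH5 (f : ℝ → ℝ) : Prop :=
  ContDiff ℝ 13 f ∧
    ∀ t ≤ 13, ∀ j ≤ 4, Integrable (fun y => y ^ j * iteratedDeriv t f y) lawH5

noncomputable section

def cL : ℕ → List ℝ
  | 1 => [-120]
  | 2 => [0, -75325]
  | 3 => [7704000, 0, -81875]
  | 4 => [0, 270600000, 0, -31250]
  | 5 => [-39086400000, 0, 527800000, 0, -3125]
  | 6 => [0, -155065000000, 0, 280000000]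
  | 7 => [14306880000000, 0, -241335000000, 0, 35000000]
  | 8 => [0, 53403600000000, 0, -198750000000]
  | 9 => [-1170432000000000, 0, 34950000000000, 0, -33125000000]
  | 10 => [0, -10843200000000000, 0, 39000000000000]
  | 11 => [352512000000000000, 0, -6696000000000000, 0, 9750000000000]
  | 12 => [0, 622080000000000000, 0, -2160000000000000]
  | 13 => [-29859840000000000000, 0, 622080000000000000, 0, -1080000000000000]
  | _ => []

def cH (t j : ℕ) : ℝ := (cL t).getD j 0

def qL : ℕ → List ℝ
  | 0 => [-3, 0, 6, 0, -1]
  | 1 => [0, -75, 0, -85, 0, 25, 0, -5]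
  | 2 => [196800, 0, -465975, 0, 71575, 0, -1050, 0, 25, 0, -25]
  | 3 => [0, 4752000, 0, -258750, 0, 1653375, 0, -642500, 0, 67250, 0, -750, 0, -125]
  | 4 => [-811800000, 0, 1587960000, 0, -269266875, 0, 25991250, 0, -9399375, 0, 2142500, 0, -283125, 0, 21250, 0, -625]
  | 5 => [0, -26909400000, 0, 14557400000, 0, -17640800000, 0, 4998200000, 0, -417200000, 0, -5600000, 0, 1400000]
  | 6 => [914352000000, 0, -503991000000, 0, 241504000000, 0, -161280000000, 0, 76342000000, 0, -21125000000, 0, 3171000000, 0, -238000000, 0, 7000000]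
  | 7 => [0, 591600000000, 0, -6239450000000, 0, 8923775000000, 0, -2141500000000, 0, 76850000000, 0, 18550000000, 0, -1325000000]
  | 8 => [-343948800000000, 0, 224115600000000, 0, -217340475000000, 0, 142271250000000, 0, -69403375000000, 0, 19820500000000, 0, -3001125000000, 0, 225250000000, 0, -6625000000]
  | 9 => [0, 3988800000000000, 0, -609216000000000, 0, -213570000000000, 0, -139008000000000, 0, 70980000000000, 0, -9360000000000, 0, 390000000000]
  | 10 => [38430720000000000, 0, -92024640000000000, 0, 69208650000000000, 0, -39983580000000000, 0, 20070690000000000, 0, -5819640000000000, 0, 883350000000000, 0, -66300000000000, 0, 1950000000000]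
  | 11 => [0, -223948800000000000, 0, 267580800000000000, 0, -244209600000000000, 0, 100742400000000000, 0, -18230400000000000, 0, 1468800000000000, 0, -43200000000000]
  | 12 => [-1990656000000000000, 0, 5349888000000000000, 0, -4723272000000000000, 0, 3881520000000000000, 0, -2183976000000000000, 0, 643680000000000000, 0, -97848000000000000, 0, 7344000000000000, 0, -216000000000000]
  | _ => []

def ev : List ℝ → ℝ → ℝ
  | [], _ => 0
  | a :: l, x => a + x * ev l x

def evd : List ℝ → ℝ → ℝ
  | [], _ => 0
  | _ :: l, x => ev l x + x * evd l x

end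

lemma cH_lt {t j : ℕ} (h : cH t j ≠ 0) : j < t := by
  by_contra hlt
  apply h
  unfold cH
  apply List.getD_eq_default
  have : (cL t).length ≤ t := by
    unfold cL
    split <;> simp
  omega

set_option maxHeartbeats 1000000 in
lemma stein_eq (f : ℝ → ℝ) (y : ℝ) : steinH5 f y = y * f y +
    ∑ t ∈ Finset.range 14, ∑ j ∈ Finset.range 5, cH t j * (y ^ j * iteratedDeriv t f y) := by
  simp only [Finset.sum_range_succ, Finset.sum_range_zero, cH, cL, List.getD_cons_zero,
    List.getD_cons_succ, List.getD_nil, steinH5, iteratedDeriv_one]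
  ring

lemma hasDerivAt_ev (l : List ℝ) (x : ℝ) : HasDerivAt (ev l) (evd l x) x := by
  induction l with
  | nil => exact hasDerivAt_const x (0 : ℝ)
  | cons a l ih =>
    have := ((hasDerivAt_id x).mul ih).const_add a
    simpa [ev, evd, id] using this

lemma ev_bound (l : List ℝ) : ∃ C : ℝ, 0 ≤ C ∧ ∀ x, |ev l x| ≤ C * (1 + |x|) ^ l.length := by
  induction l with
  | nil => exact ⟨0, le_rfl, fun x => by simp [ev]⟩
  | cons a l ih =>
    obtain ⟨C, hC, h⟩ := ih
    refine ⟨|a| + C, by positivity, fun x => ?_⟩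
    have h1 : |ev (a :: l) x| ≤ |a| + |x| * |ev l x| := by
      simp only [ev]
      exact (abs_add_le _ _).trans (by rw [abs_mul])
    have h2 : |x| * |ev l x| ≤ (1 + |x|) * (C * (1 + |x|) ^ l.length) :=
      mul_le_mul (by linarith) (h x) (abs_nonneg _) (by positivity)
    have h3 : (1:ℝ) ≤ (1 + |x|) ^ (l.length + 1) := one_le_pow₀ (by linarith [abs_nonneg x])
    have h4 : |a| ≤ |a| * (1 + |x|) ^ (l.length + 1) := le_mul_of_one_le_right (abs_nonneg _) h3
    simp only [List.length_cons]
    calc _ ≤ _ := h1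
      _ ≤ |a| * (1 + |x|) ^ (l.length + 1) + (1 + |x|) * (C * (1 + |x|) ^ l.length) := by linarith
      _ = _ := by ring

set_option maxHeartbeats 4000000 in
lemma q_rec (t : ℕ) (ht : t < 14) (x : ℝ) :
    (if t = 0 then x ^ 5 - 10 * x ^ 3 + 15 * x else 0) +
      ∑ j ∈ Finset.range 5, cH t j * (x ^ 5 - 10 * x ^ 3 + 15 * x) ^ j =
    evd (qL t) x - x * ev (qL t) x +
      (if t = 0 then 0 else ev (qL (t - 1)) x * (5 * x ^ 4 - 30 * x ^ 2 + 15)) := by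
  interval_cases t <;>
  · simp only [Finset.sum_range_succ, Finset.sum_range_zero, cH, cL, List.getD_cons_zero,
      List.getD_cons_succ, List.getD_nil, qL, ev, evd, if_true, reduceIte, Nat.reduceSub,
      OfNat.ofNat_ne_zero, one_ne_zero]
    ring

lemma qL_len (t : ℕ) : (qL t).length ≤ 17 := by
  unfold qL
  split <;> simp

noncomputable def h5 (x : ℝ) : ℝ := x ^ 5 - 10 * x ^ 3 + 15 * x

noncomputable def wG (x : ℝ) : ℝ := (Real.sqrt (2 * Real.pi))⁻¹ * Real.exp (-x ^ 2 / 2)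

lemma wG_nonneg (x : ℝ) : 0 ≤ wG x := by unfold wG; positivity

lemma wG_cont : Continuous wG := by unfold wG; fun_prop

lemma h5_cont : Continuous h5 := by unfold h5; fun_prop

lemma stdGaussian_eq : _root_.stdGaussian = gaussianReal 0 1 := by
  rw [gaussianReal_of_var_ne_zero 0 one_ne_zero]
  unfold _root_.stdGaussian
  congr 1
  funext x
  simp [gaussianPDF, gaussianPDFReal]

instance : IsProbabilityMeasure _root_.stdGaussian := by
  rw [stdGaussian_eq]; infer_instance

lemma lawH5_eq : lawH5 = Measure.map h5 _root_.stdGaussian := rfl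

instance : IsProbabilityMeasure lawH5 := by
  rw [lawH5_eq]
  exact Measure.isProbabilityMeasure_map h5_cont.measurable.aemeasurable

lemma integrable_lawH5 {g : ℝ → ℝ} (hg : Continuous g) :
    Integrable g lawH5 ↔ Integrable (fun x => wG x * g (h5 x)) := by
  rw [lawH5_eq, integrable_map_measure hg.aestronglyMeasurable h5_cont.measurable.aemeasurable]
  unfold _root_.stdGaussian
  rw [integrable_withDensity_iff_integrable_smul' (by fun_prop) (ae_of_all _ fun _ => ENNReal.ofReal_lt_top)]
  apply integrable_congr
  filter_upwards with x
  have := wG_nonneg x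
  unfold wG at *
  simp only [ENNReal.toReal_ofReal this, smul_eq_mul, Function.comp]

lemma integral_lawH5 {g : ℝ → ℝ} (hg : Continuous g) :
    ∫ y, g y ∂lawH5 = ∫ x, wG x * g (h5 x) := by
  rw [lawH5_eq, integral_map h5_cont.measurable.aemeasurable hg.aestronglyMeasurable]
  unfold _root_.stdGaussian
  rw [integral_withDensity_eq_integral_toReal_smul (by fun_prop) (ae_of_all _ fun _ => ENNReal.ofReal_lt_top)]
  congr 1
  funext x
  have := wG_nonneg x
  unfold wG at *
  simp only [ENNReal.toReal_ofReal this, smul_eq_mul, Function.comp]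

lemma hasDerivAt_wG (x : ℝ) : HasDerivAt wG (-x * wG x) x := by
  have h1 : HasDerivAt (fun x : ℝ => -x ^ 2 / 2) (-x) x := by
    have := ((hasDerivAt_pow 2 x).neg).div_const 2
    refine this.congr_deriv ?_
    norm_num
    ring
  have := (h1.exp).const_mul ((Real.sqrt (2 * Real.pi))⁻¹)
  refine this.congr_deriv ?_
  unfold wG
  ring

lemma hasDerivAt_h5 (x : ℝ) : HasDerivAt h5 (5 * x ^ 4 - 30 * x ^ 2 + 15) x := by
  have := ((hasDerivAt_pow 5 x).sub ((hasDerivAt_pow 3 x).const_mul 10)).add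
    ((hasDerivAt_id x).const_mul 15)
  refine this.congr_deriv ?_
  norm_num; ring

lemma pow_le_h5 (x : ℝ) : (1 + |x|) ^ 17 ≤ 100 ^ 17 * (1 + h5 x ^ 4) := by
  have h0 := abs_nonneg x
  have hh : 0 ≤ h5 x ^ 4 := by positivity
  by_cases hx : |x| ≤ 99
  · calc (1 + |x|) ^ 17 ≤ 100 ^ 17 := pow_le_pow_left₀ (by positivity) (by linarith) _
      _ ≤ _ := by nlinarith
  · push Not at hx
    have h1 : |x| ^ 5 / 2 ≤ |h5 x| := by
      have e : h5 x = x * (x ^ 4 - 10 * x ^ 2 + 15) := by unfold h5; ring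
      have e2 : x ^ 2 = |x| ^ 2 := (sq_abs x).symm
      have e4 : x ^ 4 = |x| ^ 4 := by rw [show x ^ 4 = (x ^ 2) ^ 2 by ring, e2]; ring
      have hp : |x| ^ 4 / 2 ≤ x ^ 4 - 10 * x ^ 2 + 15 := by
        rw [e2, e4]
        nlinarith [sq_nonneg (|x| ^ 2 - 20), mul_self_nonneg (|x|)]
      rw [e, abs_mul]
      calc |x| ^ 5 / 2 = |x| * (|x| ^ 4 / 2) := by ring
        _ ≤ |x| * |x ^ 4 - 10 * x ^ 2 + 15| :=
          mul_le_mul_of_nonneg_left (hp.trans (le_abs_self _)) h0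
    have h2 : (|x| ^ 5 / 2) ^ 4 ≤ h5 x ^ 4 := by
      have := pow_le_pow_left₀ (by positivity) h1 4
      rwa [(show Even 4 by decide).pow_abs] at this
    calc (1 + |x|) ^ 17 ≤ (2 * |x|) ^ 17 := pow_le_pow_left₀ (by positivity) (by linarith) _
      _ = 2 ^ 21 * ((|x| ^ 17 / 16) * 1) := by ring
      _ ≤ 2 ^ 21 * ((|x| ^ 17 / 16) * |x| ^ 3) := by
          gcongr; exact one_le_pow₀ (by linarith)
      _ = 2 ^ 21 * (|x| ^ 5 / 2) ^ 4 := by ring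
      _ ≤ 2 ^ 21 * h5 x ^ 4 := by gcongr
      _ ≤ _ := by nlinarith

lemma q_bound (t : ℕ) : ∃ C : ℝ, ∀ x, |ev (qL t) x| ≤ C * (1 + h5 x ^ 4) := by
  obtain ⟨C, hC, h⟩ := ev_bound (qL t)
  refine ⟨C * 100 ^ 17, fun x => (h x).trans ?_⟩
  rw [mul_assoc]
  refine mul_le_mul_of_nonneg_left (le_trans ?_ (pow_le_h5 x)) hC
  exact pow_le_pow_right₀ (by linarith [abs_nonneg x]) (qL_len t)

lemma stein_fwd (f : ℝ → ℝ) (hf : memFH5 f) : ∫ y, steinH5 f y ∂lawH5 = 0 := by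
  obtain ⟨hc, hi⟩ := hf
  have hct : ∀ t ≤ 13, Continuous (iteratedDeriv t f) := fun t ht =>
    hc.continuous_iteratedDeriv t (by exact_mod_cast ht)
  have hcs : Continuous (steinH5 f) := by
    have : steinH5 f = fun y => y * f y +
      ∑ t ∈ Finset.range 14, ∑ j ∈ Finset.range 5, cH t j * (y ^ j * iteratedDeriv t f y) :=
      funext (stein_eq f)
    rw [this]
    have := hc.continuous
    refine (continuous_id.mul this).add (continuous_finsetSum _ fun t ht => 
      continuous_finsetSum _ fun j _ => ?_)
    have := hct t (by simp at ht; omega)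
    fun_prop
  have his : Integrable (steinH5 f) lawH5 := by
    have : steinH5 f = fun y => y * f y +
      ∑ t ∈ Finset.range 14, ∑ j ∈ Finset.range 5, cH t j * (y ^ j * iteratedDeriv t f y) :=
      funext (stein_eq f)
    rw [this]
    refine Integrable.add ?_ (integrable_finsetSum _ fun t ht => 
      integrable_finsetSum _ fun j hj => ?_)
    · simpa using hi 0 (by norm_num) 1 (by norm_num)
    · exact (hi t (by simp at ht; omega) j (by simp at hj; omega)).const_mul _
  rw [integral_lawH5 hcs]
  set G : ℝ → ℝ := fun x => wG x * ∑ t ∈ Finset.range 13, ev (qL t) x * iteratedDeriv t f (h5 x)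
    with hG
  have hdt : ∀ t ≤ 12, ∀ y, HasDerivAt (iteratedDeriv t f) (iteratedDeriv (t + 1) f y) y := by
    intro t ht y
    rw [iteratedDeriv_succ]
    exact (hc.differentiable_iteratedDeriv t (by exact_mod_cast (by omega : t < 13)) y).hasDerivAt
  refine integral_eq_zero_of_hasDerivAt_of_integrable (f := G) (fun x => ?_)
    ((integrable_lawH5 hcs).1 his) ?_
  · have h1 : HasDerivAt (fun x => ∑ t ∈ Finset.range 13, ev (qL t) x * iteratedDeriv t f (h5 x))
        (∑ t ∈ Finset.range 13, (evd (qL t) x * iteratedDeriv t f (h5 x) +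
          ev (qL t) x * (iteratedDeriv (t + 1) f (h5 x) * (5 * x ^ 4 - 30 * x ^ 2 + 15)))) x := by
      apply HasDerivAt.fun_sum
      intro t ht
      exact (hasDerivAt_ev _ x).mul
        ((hdt t (by simp at ht; omega) (h5 x)).comp x (hasDerivAt_h5 x))
    refine ((hasDerivAt_wG x).mul h1).congr_deriv ?_
    symm
    rw [stein_eq]
    have key : ∀ t, t < 14 → (if t = 0 then h5 x else 0) * iteratedDeriv t f (h5 x) +
        ∑ j ∈ Finset.range 5, cH t j * (h5 x ^ j * iteratedDeriv t f (h5 x)) =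
        (evd (qL t) x - x * ev (qL t) x) * iteratedDeriv t f (h5 x) +
      (if t = 0 then 0 else ev (qL (t - 1)) x * (5 * x ^ 4 - 30 * x ^ 2 + 15)) *
        iteratedDeriv t f (h5 x) := by
      intro t ht
      rw [← add_mul, ← q_rec t ht x, add_mul, Finset.sum_mul]
      unfold h5
      simp only [mul_assoc]
    have hs := Finset.sum_congr (rfl : Finset.range 14 = Finset.range 14)
      (fun t ht => key t (Finset.mem_range.1 ht))
    rw [Finset.sum_add_distrib, Finset.sum_add_distrib] at hs
    rw [Finset.sum_range_succ' (fun t => (if t = 0 then h5 x else 0) * _),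
      Finset.sum_range_succ' (fun t => (if t = 0 then 0 else _) * _),
      Finset.sum_range_succ (fun t => (evd (qL t) x - x * ev (qL t) x) * _)] at hs
    have h13 : qL 13 = [] := rfl
    simp [h13, ev, evd] at hs
    rw [hs, Finset.sum_add_distrib, mul_add, mul_add]
    simp only [Finset.mul_sum, ← add_assoc, ← Finset.sum_add_distrib]
    refine Finset.sum_congr rfl fun t _ => ?_
    ring
  · have : G = fun x => ∑ t ∈ Finset.range 13, wG x * (ev (qL t) x * iteratedDeriv t f (h5 x)) := by
      funext x; simp only [hG, Finset.mul_sum]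
    rw [this]
    refine integrable_finsetSum _ fun t ht => ?_
    have ht' : t ≤ 13 := by simp at ht; omega
    obtain ⟨C, hC⟩ := q_bound t
    have c1 := hct t ht'
    have i0 := hi t ht' 0 (by norm_num)
    have i4 := hi t ht' 4 (by norm_num)
    rw [integrable_lawH5 (by fun_prop)] at i0 i4
    refine Integrable.mono' ((i0.norm.add i4.norm).const_mul C) ?_ ?_
    · have := wG_cont
      have := h5_cont
      have : Continuous (ev (qL t)) :=
        continuous_iff_continuousAt.2 fun x => (hasDerivAt_ev _ x).continuousAt
      exact Continuous.aestronglyMeasurable (by fun_prop)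
    · filter_upwards with x
      simp only [norm_mul, Real.norm_eq_abs, Pi.add_apply, pow_zero, one_mul, abs_pow, 
        (show Even 4 by decide).pow_abs]
      have := mul_le_mul_of_nonneg_left (mul_le_mul_of_nonneg_right (hC x)
        (abs_nonneg (iteratedDeriv t f (h5 x)))) (abs_nonneg (wG x))
      refine this.trans (le_of_eq (by ring))

lemma pow_le_exp (u : ℝ) (hu : 0 ≤ u) (m : ℕ) :
    u ^ m ≤ (m : ℝ) ^ m * Real.exp (-m) * Real.exp u := by
  rcases Nat.eq_zero_or_pos m with rfl | hm
  · simpa using hu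
  · have hm' : (0 : ℝ) < m := by exact_mod_cast hm
    have h1 : u / m ≤ Real.exp (u / m - 1) := by
      have := Real.add_one_le_exp (u / m - 1)
      linarith
    have h2 := pow_le_pow_left₀ (by positivity) h1 m
    rw [← Real.exp_nat_mul, div_pow, div_le_iff₀ (by positivity)] at h2
    refine h2.trans (le_of_eq ?_)
    rw [mul_assoc, ← Real.exp_add, mul_comm]
    congr 2
    field_simp
    ring

lemma h5_sq_le (x : ℝ) : h5 x ^ 2 ≤ (x ^ 2 + 15) ^ 5 := by
  have hu : 0 ≤ x ^ 2 := sq_nonneg x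
  have e : h5 x ^ 2 = x ^ 2 * ((x ^ 2) ^ 2 - 10 * x ^ 2 + 15) ^ 2 := by unfold h5; ring
  rw [e]
  generalize x ^ 2 = u at *
  have h1 : (u ^ 2 - 10 * u + 15) ^ 2 ≤ ((u + 15) ^ 2) ^ 2 := by
    apply sq_le_sq'
    · nlinarith
    · nlinarith
  calc _ ≤ (u + 15) * ((u + 15) ^ 2) ^ 2 :=
        mul_le_mul (by linarith) h1 (by positivity) (by positivity)
    _ = _ := by ring

lemma h5_pow_le (x : ℝ) (n : ℕ) : wG x * h5 x ^ (2 * n) ≤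
    ((100 / 9 * n : ℝ) ^ (5 * n) * Real.exp (-(5 * n))) *
      (Real.exp (27 / 4) * Real.exp (-(1 / 20) * x ^ 2)) := by
  have h1 : h5 x ^ (2 * n) ≤ (x ^ 2 + 15) ^ (5 * n) := by
    rw [pow_mul, pow_mul]
    exact pow_le_pow_left₀ (sq_nonneg _) (h5_sq_le x) n
  have h2 := pow_le_exp (9 / 20 * (x ^ 2 + 15)) (by positivity) (5 * n)
  have h3 : (x ^ 2 + 15) ^ (5 * n) ≤ ((100 / 9 * n : ℝ) ^ (5 * n) * Real.exp (-(5 * n))) *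
      Real.exp (9 / 20 * (x ^ 2 + 15)) := by
    have e : (x ^ 2 + 15) ^ (5 * n) = (20 / 9 : ℝ) ^ (5 * n) * (9 / 20 * (x ^ 2 + 15)) ^ (5 * n) := by
      rw [← mul_pow]; congr 1; ring
    have e2 : (100 / 9 * n : ℝ) ^ (5 * n) = (20 / 9 : ℝ) ^ (5 * n) * (5 * n) ^ (5 * n) := by
      rw [← mul_pow]; congr 1; ring
    rw [e, e2]
    have := mul_le_mul_of_nonneg_left h2 (by positivity : (0:ℝ) ≤ (20 / 9 : ℝ) ^ (5 * n))
    push_cast at this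
    refine this.trans (le_of_eq (by ring))
  have hw : wG x ≤ Real.exp (-x ^ 2 / 2) := by
    unfold wG
    refine mul_le_of_le_one_left (Real.exp_pos _).le ?_
    apply inv_le_one_of_one_le₀
    rw [Real.one_le_sqrt]
    linarith [Real.pi_gt_three]
  calc _ ≤ Real.exp (-x ^ 2 / 2) * (((100 / 9 * n : ℝ) ^ (5 * n) * Real.exp (-(5 * n))) *
      Real.exp (9 / 20 * (x ^ 2 + 15))) :=
        mul_le_mul hw (h1.trans h3) (by rw [pow_mul]; positivity) (Real.exp_pos _).le
    _ = ((100 / 9 * n : ℝ) ^ (5 * n) * Real.exp (-(5 * n))) *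
      (Real.exp (-x ^ 2 / 2) * Real.exp (9 / 20 * (x ^ 2 + 15))) := by ring
    _ = _ := by
      rw [← Real.exp_add, ← Real.exp_add]
      congr 2
      ring

lemma gauss_int : Integrable (fun x : ℝ => Real.exp (27 / 4) * Real.exp (-(1 / 20) * x ^ 2)) :=
  (integrable_exp_neg_mul_sq (by norm_num)).const_mul _

lemma lawH5_even_integrable (n : ℕ) : Integrable (fun y : ℝ => y ^ (2 * n)) lawH5 := by
  rw [integrable_lawH5 (by fun_prop)]
  refine Integrable.mono' (gauss_int.const_mul
    ((100 / 9 * n : ℝ) ^ (5 * n) * Real.exp (-(5 * n)))) ?_ (ae_of_all _ fun x => ?_)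
  rotate_left
  · rw [Real.norm_eq_abs, abs_of_nonneg]
    · exact h5_pow_le x n
    · exact mul_nonneg (wG_nonneg x) (by rw [pow_mul]; positivity)
  · have := wG_cont
    have := h5_cont
    exact Continuous.aestronglyMeasurable (by fun_prop)

lemma lawH5_moment_bound : ∃ C : ℝ, 0 ≤ C ∧ ∀ n : ℕ, ∫ y, y ^ (2 * n) ∂lawH5 ≤
    C * ((100 / 9 * n : ℝ) ^ (5 * n) * Real.exp (-(5 * n))) := by
  refine ⟨∫ x : ℝ, Real.exp (27 / 4) * Real.exp (-(1 / 20) * x ^ 2), 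
    integral_nonneg fun x => by positivity, fun n => ?_⟩
  rw [integral_lawH5 (by fun_prop), mul_comm (∫ _, _), ← integral_const_mul]
  refine integral_mono ?_ (gauss_int.const_mul _) fun x => h5_pow_le x n
  have := lawH5_even_integrable n
  rwa [integrable_lawH5 (by fun_prop)] at this

lemma integrable_of_even {μ : Measure ℝ} [IsFiniteMeasure μ] {m : ℕ}
    (h : Integrable (fun y : ℝ => y ^ (2 * m)) μ) {k : ℕ} (hk : k ≤ 2 * m) :
    Integrable (fun y : ℝ => y ^ k) μ := by
  refine Integrable.mono' ((integrable_const (1:ℝ)).add h)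
    (by fun_prop) (ae_of_all _ fun y => ?_)
  simp only [Pi.add_apply, Real.norm_eq_abs, abs_pow]
  have h1 : y ^ (2 * m) = |y| ^ (2 * m) := by rw [pow_mul, pow_mul, sq_abs]
  rw [h1]
  have h0 := abs_nonneg y
  rcases le_total (|y|) 1 with h | h
  · have := pow_le_one₀ h0 h (n := k)
    have : 0 ≤ |y| ^ (2 * m) := by positivity
    linarith
  · have := pow_le_pow_right₀ h hk
    linarith

lemma lawH5_integrable (k : ℕ) : Integrable (fun y : ℝ => y ^ k) lawH5 :=
  integrable_of_even (lawH5_even_integrable k) (by omega)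

lemma lawH5_symm : Measure.map (fun y => -y) lawH5 = lawH5 := by
  have h : Measure.map (fun x : ℝ => -x) _root_.stdGaussian = _root_.stdGaussian := by
    rw [stdGaussian_eq, gaussianReal_map_neg]; simp
  rw [lawH5_eq, Measure.map_map (by fun_prop) h5_cont.measurable]
  conv_rhs => rw [← h]
  rw [Measure.map_map h5_cont.measurable (by fun_prop)]
  congr 1
  funext x
  simp only [Function.comp, h5]
  ring

lemma memFH5_of_bound {f : ℝ → ℝ} (hc : ContDiff ℝ 13 f)
    (hb : ∀ t ≤ 13, ∃ C : ℝ, ∀ y, |iteratedDeriv t f y| ≤ C) : memFH5 f := by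
  refine ⟨hc, fun t ht j hj => ?_⟩
  obtain ⟨C, hC⟩ := hb t ht
  have c1 : Continuous (iteratedDeriv t f) := hc.continuous_iteratedDeriv t (by exact_mod_cast ht)
  refine Integrable.mono' ((lawH5_integrable j).norm.const_mul C)
    (Continuous.aestronglyMeasurable (by fun_prop)) (ae_of_all _ fun y => ?_)
  rw [norm_mul, mul_comm]
  exact mul_le_mul_of_nonneg_right (hC y) (norm_nonneg _)

lemma memFH5_pow (k : ℕ) : memFH5 (fun y => y ^ k) := by
  refine ⟨by fun_prop, fun t _ j _ => ?_⟩
  have e : ∀ y : ℝ, iteratedDeriv t (fun y : ℝ => y ^ k) y = k.descFactorial t * y ^ (k - t) :=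
    fun y => iteratedDeriv_pow k t
  simp only [e]
  have := (lawH5_integrable (j + (k - t))).const_mul ((k.descFactorial t : ℕ) : ℝ)
  refine this.congr (ae_of_all _ fun y => ?_)
  simp only [pow_add]; ring

lemma hcs_iter {g : ℝ → ℝ} (h : HasCompactSupport g) (t : ℕ) :
    HasCompactSupport (iteratedDeriv t g) := by
  induction t with
  | zero => simpa using h
  | succ t ih => rw [iteratedDeriv_succ]; exact ih.deriv

lemma iter_cutoff (m : ℕ) (χ : ℝ → ℝ) (h1 : ContDiff ℝ (⊤ : ℕ∞) χ) (h2 : HasCompactSupport χ)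
    (t : ℕ) (ht : t ≤ m) : ∃ ψ : ℝ → ℝ, ContDiff ℝ (⊤ : ℕ∞) ψ ∧ HasCompactSupport ψ ∧
      iteratedDeriv t (fun z => z ^ m * χ z) = fun z => z ^ (m - t) * ψ z := by
  induction t with
  | zero => exact ⟨χ, h1, h2, by simp⟩
  | succ t ih =>
    obtain ⟨ψ, c1, c2, e⟩ := ih (by omega)
    have hd : ∀ z, HasDerivAt ψ (deriv ψ z) z := fun z =>
      ((c1.differentiable (by simp)) z).hasDerivAt
    refine ⟨fun z => ((m - t : ℕ) : ℝ) * ψ z + z * deriv ψ z, ?_, ?_, ?_⟩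
    · have : ContDiff ℝ (⊤ : ℕ∞) (deriv ψ) := by
        have := (contDiff_infty_iff_deriv.1 c1).2
        exact this
      fun_prop
    · exact (c2.mul_left (f := fun _ => ((m - t : ℕ) : ℝ))).add
        (c2.deriv.mul_left (f := fun z : ℝ => z))
    · rw [iteratedDeriv_succ, e]
      funext z
      rw [((hasDerivAt_pow (m - t) z).fun_mul (hd z)).deriv]
      obtain ⟨r, hr⟩ : ∃ r, m - t = r + 1 := ⟨m - t - 1, by omega⟩
      rw [show m - (t + 1) = r by omega, hr]
      simp only [Nat.add_sub_cancel]
      ring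

lemma cutoff_bound (m k : ℕ) (hk : 4 ≤ k) (hm : m = k + 1)
    (χ : ℝ → ℝ) (h1 : ContDiff ℝ (⊤ : ℕ∞) χ) (h2 : HasCompactSupport χ)
    (t : ℕ) : ∃ C : ℝ, 0 ≤ C ∧ ∀ j, j < t → j ≤ 4 → ∀ c y : ℝ, 0 < c → c ≤ 1 →
      |y ^ j * (c ^ t * iteratedDeriv t (fun z => z ^ m * χ z) (c * y))|
        ≤ C * (c ^ m * (1 + |y| ^ k)) := by
  have hpow : ∀ (y : ℝ) (i : ℕ), i ≤ k → |y| ^ i ≤ 1 + |y| ^ k := by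
    intro y i hi
    have h0 := abs_nonneg y
    rcases le_total (|y|) 1 with h | h
    · have := pow_le_one₀ h0 h (n := i)
      have : 0 ≤ |y| ^ k := by positivity
      linarith
    · have := pow_le_pow_right₀ h hi
      linarith
  by_cases ht : t ≤ m
  · obtain ⟨ψ, c1, c2, e⟩ := iter_cutoff m χ h1 h2 t ht
    obtain ⟨C, hC⟩ := c2.exists_bound_of_continuous c1.continuous
    have hC0 : 0 ≤ C := (norm_nonneg _).trans (hC 0)
    refine ⟨C, hC0, fun j hj hj4 c y hc hc1 => ?_⟩
    rw [e]
    simp only []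
    have e2 : y ^ j * (c ^ t * ((c * y) ^ (m - t) * ψ (c * y))) =
      (c ^ m * y ^ (j + (m - t))) * ψ (c * y) := by
      have e3 : c ^ m = c ^ t * c ^ (m - t) := by rw [← pow_add]; congr 1; omega
      rw [mul_pow, pow_add, e3]; ring
    rw [e2, abs_mul, abs_mul, abs_pow, abs_pow, abs_of_pos hc]
    have := hpow y (j + (m - t)) (by omega)
    have h3 := hC (c * y)
    rw [Real.norm_eq_abs] at h3
    calc _ ≤ c ^ m * (1 + |y| ^ k) * C := by gcongr
      _ = _ := by ring
  · have hg : ContDiff ℝ (⊤ : ℕ∞) (fun z => z ^ m * χ z) := by fun_prop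
    have hs : HasCompactSupport (fun z => z ^ m * χ z) := h2.mul_left (f := fun z : ℝ => z ^ m)
    obtain ⟨C, hC⟩ := (hcs_iter hs t).exists_bound_of_continuous
      (hg.continuous_iteratedDeriv t (by exact_mod_cast le_top))
    have hC0 : 0 ≤ C := (norm_nonneg _).trans (hC 0)
    refine ⟨C, hC0, fun j hj hj4 c y hc hc1 => ?_⟩
    rw [abs_mul, abs_mul, abs_pow, abs_pow, abs_of_pos hc]
    have := hpow y j (by omega)
    have h3 := hC (c * y)
    rw [Real.norm_eq_abs] at h3
    have h4 : c ^ t ≤ c ^ m := pow_le_pow_of_le_one hc.le hc1 (by omega)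
    calc _ ≤ (1 + |y| ^ k) * (c ^ m * C) := by gcongr
      _ = _ := by ring

/-- expansion of the integral of the Stein operator -/
lemma integral_stein {μ : Measure ℝ} {f : ℝ → ℝ} (h0 : Integrable (fun y => y * f y) μ)
    (h : ∀ t ≤ 13, ∀ j ≤ 4, j < t → Integrable (fun y => y ^ j * iteratedDeriv t f y) μ) :
    ∫ y, steinH5 f y ∂μ = ∫ y, y * f y ∂μ +
      ∑ t ∈ Finset.range 14, ∑ j ∈ Finset.range 5, cH t j *
        ∫ y, y ^ j * iteratedDeriv t f y ∂μ := by
  have hi : ∀ t ∈ Finset.range 14, ∀ j ∈ Finset.range 5,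
      Integrable (fun y => cH t j * (y ^ j * iteratedDeriv t f y)) μ := by
    intro t ht j hj
    by_cases hc : cH t j = 0
    · simp [hc]
    · exact (h t (by simp at ht; omega) j (by simp at hj; omega) (cH_lt hc)).const_mul _
  have e : steinH5 f = fun y => y * f y +
      ∑ t ∈ Finset.range 14, ∑ j ∈ Finset.range 5, cH t j * (y ^ j * iteratedDeriv t f y) :=
      funext (stein_eq f)
  rw [e, integral_add h0 (integrable_finsetSum _ fun t ht => integrable_finsetSum _ (hi t ht)),
    integral_finsetSum _ fun t ht => integrable_finsetSum _ (hi t ht)]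
  congr 1
  refine Finset.sum_congr rfl fun t ht => ?_
  rw [integral_finsetSum _ (hi t ht)]
  exact Finset.sum_congr rfl fun j _ => integral_const_mul _ _

lemma moment_step {μ : Measure ℝ} [IsFiniteMeasure μ]
    (hS : ∀ f : ℝ → ℝ, memFH5 f → ∫ y, steinH5 f y ∂μ = 0) (n : ℕ) (hn : 2 ≤ n)
    (hi : Integrable (fun y : ℝ => y ^ (2 * n)) μ) :
    Integrable (fun y : ℝ => y ^ (2 * (n + 1))) μ := by
  let χ : ContDiffBump (0 : ℝ) := ⟨1, 2, by norm_num, by norm_num⟩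
  have h1 : ContDiff ℝ (⊤ : ℕ∞) (χ : ℝ → ℝ) := χ.contDiff
  have h2 : HasCompactSupport (χ : ℝ → ℝ) := χ.hasCompactSupport
  have hb := cutoff_bound (2 * n + 1) (2 * n) (by omega) rfl χ h1 h2
  choose D hD0 hD using hb
  set g : ℝ → ℝ := fun z => z ^ (2 * n + 1) * χ z with hg
  have hgc : ContDiff ℝ (⊤ : ℕ∞) g := by fun_prop
  have hgs : HasCompactSupport g := h2.mul_left (f := fun z : ℝ => z ^ (2 * n + 1))
  set A : ℝ := ∫ y : ℝ, (1 + |y| ^ (2 * n)) ∂μ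
  have hiA : Integrable (fun y : ℝ => 1 + |y| ^ (2 * n)) μ := by
    refine (integrable_const (1:ℝ)).add (hi.congr (ae_of_all _ fun y => ?_))
    simp only [pow_mul, sq_abs]
  set B : ℝ := ∑ t ∈ Finset.range 14, ∑ j ∈ Finset.range 5, |cH t j| * (D t * A) with hB
  have main : ∀ c : ℝ, 0 < c → c ≤ 1 →
      ∫ y, y ^ (2 * n + 2) * χ (c * y) ∂μ ≤ B ∧
      Integrable (fun y => y ^ (2 * n + 2) * χ (c * y)) μ := by
    intro c hc hc1
    have hit : ∀ t, iteratedDeriv t (fun y => g (c * y)) = fun y => c ^ t * iteratedDeriv t g (c * y) := by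
      intro t
      have := iteratedDeriv_comp_const_mul (n := t) (hgc.of_le (by exact_mod_cast le_top)) c
      rw [this]
    have hcd : ContDiff ℝ (⊤ : ℕ∞) (fun y => g (c * y)) := by fun_prop
    have hmem : memFH5 (fun y => g (c * y)) := by
      refine memFH5_of_bound (by exact_mod_cast contDiff_infty.1 hcd 13) fun t _ => ?_
      obtain ⟨C, hC⟩ := (hcs_iter hgs t).exists_bound_of_continuous
        (hgc.continuous_iteratedDeriv t (by exact_mod_cast le_top))
      refine ⟨c ^ t * C, fun y => ?_⟩
      rw [hit]
      simp only [abs_mul, abs_pow, abs_of_pos hc]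
      exact mul_le_mul_of_nonneg_left (hC (c * y)) (by positivity)
    have hij : ∀ t ≤ 13, ∀ j ≤ 4, j < t →
        Integrable (fun y => y ^ j * iteratedDeriv t (fun y => g (c * y)) y) μ := by
      intro t ht j hj hjt
      have hct : Continuous (iteratedDeriv t g) :=
        hgc.continuous_iteratedDeriv t (by exact_mod_cast le_top)
      refine Integrable.mono' ((hiA.const_mul (c ^ (2 * n + 1))).const_mul (D t)) ?_
        (ae_of_all _ fun y => ?_)
      · rw [hit]
        exact Continuous.aestronglyMeasurable (by fun_prop)
      · rw [hit]
        exact hD t j hjt hj c y hc hc1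
    have hcχ : Continuous (χ : ℝ → ℝ) := h1.continuous
    have hi0' : Integrable (fun y => y ^ (2 * n + 2) * χ (c * y)) μ := by
      have hcs : HasCompactSupport (fun y => y ^ (2 * n + 2) * χ (c * y)) := by
        refine HasCompactSupport.mul_left (f := fun y : ℝ => y ^ (2 * n + 2)) ?_
        have := h2.comp_homeomorph (Homeomorph.mulLeft₀ c hc.ne')
        simpa [Function.comp_def] using this
      exact Continuous.integrable_of_hasCompactSupport (by fun_prop) hcs
    have e0 : (fun y => y * g (c * y)) = fun y => c ^ (2 * n + 1) * (y ^ (2 * n + 2) * χ (c * y)) := by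
      funext y; simp only [hg, mul_pow]; ring
    have hi0 : Integrable (fun y => y * g (c * y)) μ := by
      rw [e0]; exact hi0'.const_mul _
    have hz := hS _ hmem
    rw [integral_stein hi0 hij, e0, integral_const_mul] at hz
    refine ⟨?_, hi0'⟩
    have hcp : 0 < c ^ (2 * n + 1) := by positivity
    refine le_of_mul_le_mul_left ?_ hcp
    have hle : -(∑ t ∈ Finset.range 14, ∑ j ∈ Finset.range 5, cH t j *
        ∫ y, y ^ j * iteratedDeriv t (fun y => g (c * y)) y ∂μ) ≤ c ^ (2 * n + 1) * B := by
      rw [hB, Finset.mul_sum, ← Finset.sum_neg_distrib]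
      refine Finset.sum_le_sum fun t ht => ?_
      rw [Finset.mul_sum, ← Finset.sum_neg_distrib]
      refine Finset.sum_le_sum fun j hj => ?_
      by_cases hc0 : cH t j = 0
      · simp [hc0]
      have hjt := cH_lt hc0
      have hj4 : j ≤ 4 := by simp at hj; omega
      have : |∫ y, y ^ j * iteratedDeriv t (fun y => g (c * y)) y ∂μ| ≤
          ∫ y, D t * (c ^ (2 * n + 1) * (1 + |y| ^ (2 * n))) ∂μ := by
        rw [← Real.norm_eq_abs]
        refine norm_integral_le_of_norm_le ((hiA.const_mul (c ^ (2 * n + 1))).const_mul (D t))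
          (ae_of_all _ fun y => ?_)
        rw [hit]
        exact hD t j hjt hj4 c y hc hc1
      rw [integral_const_mul, integral_const_mul] at this
      calc _ ≤ |cH t j * ∫ y, y ^ j * iteratedDeriv t (fun y => g (c * y)) y ∂μ| := neg_le_abs _
        _ = |cH t j| * |∫ y, y ^ j * iteratedDeriv t (fun y => g (c * y)) y ∂μ| := abs_mul _ _
        _ ≤ |cH t j| * (D t * (c ^ (2 * n + 1) * A)) := by gcongr
        _ = _ := by ring
    linarith
  have hev : ∀ y : ℝ, 0 ≤ y ^ (2 * n + 2) := fun y => by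
    rw [show 2 * n + 2 = 2 * (n + 1) by ring, pow_mul]; positivity
  have hcov : AECover μ atTop (fun i : ℕ => Metric.closedBall (0 : ℝ) ((i : ℝ) + 1)) :=
    aecover_closedBall (tendsto_atTop_add_const_right _ _ tendsto_natCast_atTop_atTop)
  refine hcov.integrable_of_integral_bounded_of_nonneg_ae B (fun i => ?_)
    (ae_of_all _ hev) (Eventually.of_forall fun i => ?_)
  · exact (Continuous.continuousOn (by fun_prop)).integrableOn_compact (isCompact_closedBall _ _)
  · have hpos : (0:ℝ) < (i : ℝ) + 1 := by positivity
    obtain ⟨m1, m2⟩ := main (((i : ℝ) + 1)⁻¹) (by positivity) (inv_le_one_of_one_le₀ (by simp))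
    refine le_trans ?_ m1
    rw [← integral_indicator measurableSet_closedBall]
    refine integral_mono_of_nonneg (ae_of_all _ fun y => ?_) m2 (ae_of_all _ fun y => ?_)
    · exact indicator_nonneg (fun y _ => hev y) y
    · by_cases hy : y ∈ Metric.closedBall (0 : ℝ) ((i : ℝ) + 1)
      · rw [indicator_of_mem hy]
        have : χ ((((i : ℝ) + 1)⁻¹) * y) = 1 := by
          apply χ.one_of_mem_closedBall
          simp only [Metric.mem_closedBall, dist_zero_right, Real.norm_eq_abs] at hy ⊢
          rw [abs_mul, abs_of_pos (by positivity), inv_mul_le_iff₀ hpos]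
          simpa [χ] using hy
        simp only [this, mul_one]
        exact le_of_eq (by ring)
      · rw [indicator_of_notMem hy]
        exact mul_nonneg (hev y) χ.nonneg

lemma moments_all {μ : Measure ℝ} [IsFiniteMeasure μ]
    (hS : ∀ f : ℝ → ℝ, memFH5 f → ∫ y, steinH5 f y ∂μ = 0)
    (hi : Integrable (fun y : ℝ => y ^ 4) μ) (k : ℕ) : Integrable (fun y : ℝ => y ^ k) μ := by
  have : ∀ n, Integrable (fun y : ℝ => y ^ (2 * (n + 2))) μ := by
    intro n
    induction n with
    | zero => simpa using hi
    | succ n ih => exact moment_step hS (n + 2) (by omega) ih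
  exact integrable_of_even (this k) (by omega)

lemma moments_eq {μ ν : Measure ℝ} [IsProbabilityMeasure μ] [IsProbabilityMeasure ν]
    (hS : ∀ f : ℝ → ℝ, memFH5 f → ∫ y, steinH5 f y ∂μ = 0)
    (hS' : ∀ f : ℝ → ℝ, memFH5 f → ∫ y, steinH5 f y ∂ν = 0)
    (hi : ∀ k : ℕ, Integrable (fun y : ℝ => y ^ k) μ)
    (hi' : ∀ k : ℕ, Integrable (fun y : ℝ => y ^ k) ν) (k : ℕ) :
    ∫ y, y ^ k ∂μ = ∫ y, y ^ k ∂ν := by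
  induction k using Nat.strong_induction_on with
  | _ k ih =>
    rcases k with _ | k
    · simp
    · have e : ∀ t, iteratedDeriv t (fun y : ℝ => y ^ k) =
          fun y : ℝ => (k.descFactorial t : ℝ) * y ^ (k - t) :=
        fun t => funext fun y => iteratedDeriv_pow k t
      have e2 : ∀ t j, (fun y : ℝ => y ^ j * iteratedDeriv t (fun y : ℝ => y ^ k) y) =
          fun y => (k.descFactorial t : ℝ) * y ^ (j + (k - t)) := by
        intro t j; funext y; rw [e]; simp only [pow_add]; ring
      have e0 : (fun y : ℝ => y * y ^ k) = fun y => y ^ (k + 1) := by funext y; ring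
      have A : ∀ {ρ : Measure ℝ}, (∀ f : ℝ → ℝ, memFH5 f → ∫ y, steinH5 f y ∂ρ = 0) →
          (∀ k : ℕ, Integrable (fun y : ℝ => y ^ k) ρ) →
          ∫ y, y ^ (k + 1) ∂ρ = -∑ t ∈ Finset.range 14, ∑ j ∈ Finset.range 5, cH t j *
            ((k.descFactorial t : ℝ) * ∫ y, y ^ (j + (k - t)) ∂ρ) := by
        intro ρ h1 h2
        have := h1 _ (memFH5_pow k)
        rw [integral_stein (by rw [e0]; exact h2 _) (fun t _ j _ _ => by
          rw [e2]; exact (h2 _).const_mul _)] at this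
        simp only [e2, e0, integral_const_mul] at this
        linarith
      rw [A hS hi, A hS' hi']
      congr 1
      refine Finset.sum_congr rfl fun t _ => Finset.sum_congr rfl fun j _ => ?_
      by_cases hc : cH t j = 0
      · simp [hc]
      have := cH_lt hc
      by_cases htk : t ≤ k
      · rw [ih (j + (k - t)) (by omega)]
      · rw [Nat.descFactorial_eq_zero_iff_lt.2 (by omega)]; simp

noncomputable def phi (μ : Measure ℝ) (j : ℕ) (s : ℝ) : ℝ :=
  ∫ y, y ^ j * Real.cos (s * y + j * (Real.pi / 2)) ∂μ

lemma phi_integrable {μ : Measure ℝ} (hi : ∀ k : ℕ, Integrable (fun y : ℝ => y ^ k) μ)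
    (j : ℕ) (a b : ℝ) : Integrable (fun y => y ^ j * Real.cos (a * y + b)) μ := by
  refine Integrable.mono' (hi j).norm (Continuous.aestronglyMeasurable (by fun_prop))
    (ae_of_all _ fun y => ?_)
  rw [norm_mul]
  exact mul_le_of_le_one_right (norm_nonneg _) (Real.abs_cos_le_one _)

lemma hasDerivAt_phi {μ : Measure ℝ} (hi : ∀ k : ℕ, Integrable (fun y : ℝ => y ^ k) μ)
    (j : ℕ) (s : ℝ) : HasDerivAt (phi μ j) (phi μ (j + 1) s) s := by
  have := hasDerivAt_integral_of_dominated_loc_of_deriv_le (μ := μ) (x₀ := s)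
    (F := fun s y => y ^ j * Real.cos (s * y + j * (Real.pi / 2)))
    (F' := fun s y => y ^ (j + 1) * Real.cos (s * y + ((j + 1 : ℕ) : ℝ) * (Real.pi / 2)))
    (bound := fun y => ‖y ^ (j + 1)‖) (s := Set.univ) univ_mem
    (Eventually.of_forall fun x => Continuous.aestronglyMeasurable (by fun_prop))
    (phi_integrable hi j _ _) (Continuous.aestronglyMeasurable (by fun_prop))
    (ae_of_all _ fun y x _ => ?_) (hi (j + 1)).norm (ae_of_all _ fun y x _ => ?_)
  · exact this.2
  · rw [norm_mul]
    exact mul_le_of_le_one_right (norm_nonneg _) (Real.abs_cos_le_one _)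
  · have h1 : HasDerivAt (fun x : ℝ => x * y + j * (Real.pi / 2)) y x := by
      simpa using ((hasDerivAt_id x).mul_const y).add_const (j * (Real.pi / 2))
    refine (h1.cos.const_mul (y ^ j)).congr_deriv ?_
    have : x * y + ((j + 1 : ℕ) : ℝ) * (Real.pi / 2) = (x * y + j * (Real.pi / 2)) + Real.pi / 2 := by
      push_cast; ring
    rw [this, Real.cos_add_pi_div_two, pow_succ]
    ring

lemma phi_zero (μ : Measure ℝ) (j : ℕ) :
    phi μ j 0 = Real.cos (j * (Real.pi / 2)) * ∫ y, y ^ j ∂μ := by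
  unfold phi
  rw [← integral_const_mul]
  congr 1
  funext y
  simp only [zero_mul, zero_add]
  ring

lemma phi_le {μ : Measure ℝ} (hi : ∀ k : ℕ, Integrable (fun y : ℝ => y ^ k) μ) (n : ℕ) (s : ℝ) :
    |phi μ (2 * n) s| ≤ ∫ y, y ^ (2 * n) ∂μ := by
  unfold phi
  rw [← Real.norm_eq_abs]
  refine norm_integral_le_of_norm_le (hi _) (ae_of_all _ fun y => ?_)
  rw [norm_mul]
  refine (mul_le_of_le_one_right (norm_nonneg _) (Real.abs_cos_le_one _)).trans (le_of_eq ?_)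
  rw [Real.norm_eq_abs, abs_of_nonneg]
  rw [pow_mul]; positivity

lemma descend (d : ℕ → ℝ → ℝ) (hd : ∀ j s, HasDerivAt (d j) (d (j + 1) s) s)
    (h0 : ∀ j, d j 0 = 0) (N : ℕ) (M : ℝ) (hM : ∀ s, |d N s| ≤ M) (i : ℕ) (hi : i ≤ N) :
    ∀ s, 0 ≤ s → |d (N - i) s| ≤ M * (s ^ i / (i.factorial : ℝ)) := by
  induction i with
  | zero => intro s _; simpa using hM s
  | succ i ih =>
    intro s hs
    have ih' := ih (by omega)
    obtain ⟨k, hk⟩ : ∃ k, N - (i + 1) = k := ⟨_, rfl⟩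
    rw [show N - i = k + 1 by omega] at ih'
    rw [hk]
    have hB : ∀ x : ℝ, HasDerivAt (fun x : ℝ => M * (x ^ (i + 1) / ((i + 1).factorial : ℝ)))
        (M * (x ^ i / (i.factorial : ℝ))) x := by
      intro x
      refine (((hasDerivAt_pow (i + 1) x).div_const _).const_mul M).congr_deriv ?_
      have : (i.factorial : ℝ) ≠ 0 := by positivity
      rw [Nat.factorial_succ]
      push_cast
      field_simp
      try simp
    have := image_norm_le_of_norm_deriv_right_le_deriv_boundary (f := d k) (f' := d (k + 1))
      (a := 0) (b := s) (B := fun x : ℝ => M * (x ^ (i + 1) / ((i + 1).factorial : ℝ)))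
      (fun x _ => (hd k x).continuousAt.continuousWithinAt)
      (fun x _ => (hd k x).hasDerivWithinAt) (by simp [h0]) hB
      (fun x hx => ih' x hx.1)
    exact this (right_mem_Icc.2 hs)

lemma iter_sin (s : ℝ) (t : ℕ) : iteratedDeriv t (fun y => Real.sin (s * y)) =
    fun y => s ^ t * Real.sin (s * y + t * (Real.pi / 2)) := by
  induction t with
  | zero => simp
  | succ t ih =>
    rw [iteratedDeriv_succ, ih]
    funext y
    have h1 : HasDerivAt (fun y : ℝ => s * y + t * (Real.pi / 2)) s y := by
      simpa using ((hasDerivAt_id y).const_mul s).add_const (t * (Real.pi / 2))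
    rw [(h1.sin.const_mul (s ^ t)).deriv]
    have : s * y + ((t + 1 : ℕ) : ℝ) * (Real.pi / 2) = (s * y + t * (Real.pi / 2)) + Real.pi / 2 := by
      push_cast; ring
    rw [this, Real.sin_add_pi_div_two, pow_succ]
    ring

lemma memFH5_sin (s : ℝ) : memFH5 (fun y => Real.sin (s * y)) := by
  refine memFH5_of_bound (by fun_prop) fun t _ => ⟨|s| ^ t, fun y => ?_⟩
  rw [iter_sin]
  simp only [abs_mul, abs_pow]
  exact mul_le_of_le_one_right (by positivity) (Real.abs_sin_le_one _)

noncomputable def q0 (s : ℝ) : ℝ := (120) + (7704000) * s ^ 2 + (39086400000) * s ^ 4 + (14306880000000) * s ^ 6 + (1170432000000000) * s ^ 8 + (352512000000000000) * s ^ 10 + (29859840000000000000) * s ^ 12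

noncomputable def q1 (s : ℝ) : ℝ := (75325) + (270600000) * s ^ 2 + (155065000000) * s ^ 4 + (53403600000000) * s ^ 6 + (10843200000000000) * s ^ 8 + (622080000000000000) * s ^ 10

noncomputable def q2 (s : ℝ) : ℝ := (81875) + (527800000) * s ^ 2 + (241335000000) * s ^ 4 + (34950000000000) * s ^ 6 + (6696000000000000) * s ^ 8 + (622080000000000000) * s ^ 10

noncomputable def q3 (s : ℝ) : ℝ := (31250) + (280000000) * s ^ 2 + (198750000000) * s ^ 4 + (39000000000000) * s ^ 6 + (2160000000000000) * s ^ 8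

noncomputable def r4 (s : ℝ) : ℝ := (35000000) + (33125000000) * s ^ 2 + (9750000000000) * s ^ 4 + (1080000000000000) * s ^ 6

set_option maxHeartbeats 1000000 in
lemma phi_ode {μ : Measure ℝ} (hi : ∀ k : ℕ, Integrable (fun y : ℝ => y ^ k) μ)
    (hS : ∀ f : ℝ → ℝ, memFH5 f → ∫ y, steinH5 f y ∂μ = 0) (s : ℝ) :
    s ^ 5 * (3125 + s ^ 2 * r4 s) * phi μ 4 s + s ^ 4 * q3 s * phi μ 3 s + s ^ 3 * q2 s * phi μ 2 s
      + (1 + s ^ 2 * q1 s) * phi μ 1 s + s * q0 s * phi μ 0 s = 0 := by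
  have e : ∀ t j i : ℕ, t = j + 1 + 2 * i → 
      (fun y : ℝ => y ^ j * iteratedDeriv t (fun y => Real.sin (s * y)) y) =
      fun y => ((-1) ^ i * s ^ t) * (y ^ j * Real.cos (s * y + j * (Real.pi / 2))) := by
    intro t j i ht
    funext y
    rw [iter_sin]
    have : s * y + (t : ℝ) * (Real.pi / 2) = (s * y + j * (Real.pi / 2) + Real.pi / 2) + i * Real.pi := by
      rw [ht]; push_cast; ring
    simp only [this, Real.sin_add_nat_mul_pi, Real.sin_add_pi_div_two]
    ring
  have T : ∀ t j i : ℕ, t = j + 1 + 2 * i →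
      ∫ y, y ^ j * iteratedDeriv t (fun y => Real.sin (s * y)) y ∂μ =
        (-1) ^ i * s ^ t * phi μ j s := by
    intro t j i ht
    rw [e t j i ht, integral_const_mul, phi]
  have e0 : (fun y : ℝ => y * Real.sin (s * y)) =
      fun y => (-1) * (y ^ 1 * Real.cos (s * y + ((1 : ℕ) : ℝ) * (Real.pi / 2))) := by
    funext y
    rw [Nat.cast_one, one_mul, Real.cos_add_pi_div_two]; ring
  have hz := hS _ (memFH5_sin s)
  rw [integral_stein (by rw [e0]; exact (phi_integrable hi _ _ _).const_mul _) (fun t _ j _ _ => by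
    refine Integrable.mono' ((hi j).norm.const_mul (|s| ^ t)) ?_ (ae_of_all _ fun y => ?_)
    · rw [iter_sin]; exact Continuous.aestronglyMeasurable (by fun_prop)
    · rw [iter_sin]
      simp only [norm_mul, norm_pow, Real.norm_eq_abs]
      have : |y| ^ j * (|s| ^ t * |Real.sin (s * y + t * (Real.pi / 2))|) ≤ |y| ^ j * (|s| ^ t * 1) := by
        gcongr
        exact Real.abs_sin_le_one _
      exact this.trans (le_of_eq (by ring))), e0, integral_const_mul] at hz
  rw [← phi.eq_1 μ 1 s] at hz
  simp only [Finset.sum_range_succ, Finset.sum_range_zero, cH, cL, List.getD_cons_zero,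
    List.getD_cons_succ, List.getD_nil, zero_mul, add_zero, zero_add,
    T 1 0 0 rfl, T 2 1 0 rfl, T 3 0 1 rfl, T 3 2 0 rfl, T 4 1 1 rfl,
    T 4 3 0 rfl, T 5 0 2 rfl, T 5 2 1 rfl, T 5 4 0 rfl, T 6 1 2 rfl,
    T 6 3 1 rfl, T 7 0 3 rfl, T 7 2 2 rfl, T 7 4 1 rfl, T 8 1 3 rfl,
    T 8 3 2 rfl, T 9 0 4 rfl, T 9 2 3 rfl, T 9 4 2 rfl, T 10 1 4 rfl,
    T 10 3 3 rfl, T 11 0 5 rfl, T 11 2 4 rfl, T 11 4 3 rfl, T 12 1 5 rfl,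
    T 12 3 4 rfl, T 13 0 6 rfl, T 13 2 5 rfl, T 13 4 4 rfl] at hz
  unfold r4 q3 q2 q1 q0
  linear_combination -hz

noncomputable def Qe (d : ℕ → ℝ → ℝ) (σ : ℝ) : ℝ :=
  d 0 (σ ^ 3 / 5) ^ 2 + d 1 (σ ^ 3 / 5) ^ 2 + σ ^ 10 * d 2 (σ ^ 3 / 5) ^ 2
    + σ ^ 20 * d 3 (σ ^ 3 / 5) ^ 2

noncomputable def Qd (d : ℕ → ℝ → ℝ) (σ : ℝ) : ℝ :=
  6 / 5 * σ ^ 2 * (d 0 (σ ^ 3 / 5) * d 1 (σ ^ 3 / 5) + d 1 (σ ^ 3 / 5) * d 2 (σ ^ 3 / 5)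
    + σ ^ 10 * (d 2 (σ ^ 3 / 5) * d 3 (σ ^ 3 / 5))
    + σ ^ 20 * (d 3 (σ ^ 3 / 5) * d 4 (σ ^ 3 / 5)))
    + 10 * σ ^ 9 * d 2 (σ ^ 3 / 5) ^ 2 + 20 * σ ^ 19 * d 3 (σ ^ 3 / 5) ^ 2

lemma hasDerivAt_Qe (d : ℕ → ℝ → ℝ) (hd : ∀ j s, HasDerivAt (d j) (d (j + 1) s) s) (σ : ℝ) :
    HasDerivAt (Qe d) (Qd d σ) σ := by
  have h3 : HasDerivAt (fun σ : ℝ => σ ^ 3 / 5) (3 / 5 * σ ^ 2) σ := by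
    refine ((hasDerivAt_pow 3 σ).div_const 5).congr_deriv ?_
    norm_num; ring
  have hj : ∀ j, HasDerivAt (fun σ : ℝ => d j (σ ^ 3 / 5))
      (d (j + 1) (σ ^ 3 / 5) * (3 / 5 * σ ^ 2)) σ := fun j => (hd j _).comp σ h3
  have := ((((hj 0).fun_pow 2).fun_add ((hj 1).fun_pow 2)).fun_add
    ((hasDerivAt_pow 10 σ).fun_mul ((hj 2).fun_pow 2))).fun_add
    ((hasDerivAt_pow 20 σ).fun_mul ((hj 3).fun_pow 2))
  refine this.congr_deriv ?_
  unfold Qd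
  norm_num
  ring

lemma abs_mul_le_Q {a b Q : ℝ} (ha : a ^ 2 ≤ Q) (hb : b ^ 2 ≤ Q) : |a * b| ≤ Q := by
  rw [abs_le]; constructor <;> nlinarith [sq_nonneg (a + b), sq_nonneg (a - b)]

set_option maxHeartbeats 2000000 in
/-- the algebraic heart of the energy estimate -/
lemma energy_alg (M S σ d0 d1 d2 d3 d4 a0 a1 a2 a3 b4 : ℝ) (hσ : 0 < σ) (hσS : σ ≤ S)
    (hS : 1 ≤ S)
    (h0 : |a0| ≤ M) (h1 : |a1| ≤ M) (h2 : |a2| ≤ M) (h3 : |a3| ≤ M) (h4 : |b4| ≤ M) (hb : 0 ≤ b4)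
    (ode : (σ ^ 3 / 5) ^ 5 * (3125 + (σ ^ 3 / 5) ^ 2 * b4) * d4 + (σ ^ 3 / 5) ^ 4 * a3 * d3
      + (σ ^ 3 / 5) ^ 3 * a2 * d2 + (1 + (σ ^ 3 / 5) ^ 2 * a1) * d1 + (σ ^ 3 / 5) * a0 * d0 = 0) :
    σ ^ 3 * (6 / 5 * σ ^ 2 * (d0 * d1 + d1 * d2 + σ ^ 10 * (d2 * d3) + σ ^ 20 * (d3 * d4))
      + 10 * σ ^ 9 * d2 ^ 2 + 20 * σ ^ 19 * d3 ^ 2) ≤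
    (3 / 5 + σ ^ 2 * (6 / 5 * (S ^ 3 + 5 * (M * S ^ 4)) + 30)) *
      (d0 ^ 2 + d1 ^ 2 + σ ^ 10 * d2 ^ 2 + σ ^ 20 * d3 ^ 2) := by
  set Q := d0 ^ 2 + d1 ^ 2 + σ ^ 10 * d2 ^ 2 + σ ^ 20 * d3 ^ 2 with hQ
  have hM : 0 ≤ M := (abs_nonneg _).trans h0
  obtain ⟨v2, hv2⟩ : ∃ v, v = σ ^ 5 * d2 := ⟨_, rfl⟩
  obtain ⟨v3, hv3⟩ : ∃ v, v = σ ^ 10 * d3 := ⟨_, rfl⟩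
  have hQ' : Q = d0 ^ 2 + d1 ^ 2 + v2 ^ 2 + v3 ^ 2 := by rw [hQ, hv2, hv3]; ring
  have b0 : d0 ^ 2 ≤ Q := by rw [hQ']; nlinarith [sq_nonneg d1, sq_nonneg v2, sq_nonneg v3]
  have b1 : d1 ^ 2 ≤ Q := by rw [hQ']; nlinarith [sq_nonneg d0, sq_nonneg v2, sq_nonneg v3]
  have b2 : v2 ^ 2 ≤ Q := by rw [hQ']; nlinarith [sq_nonneg d1, sq_nonneg d0, sq_nonneg v3]
  have b3 : v3 ^ 2 ≤ Q := by rw [hQ']; nlinarith [sq_nonneg d1, sq_nonneg v2, sq_nonneg d0]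
  have hQ0 : 0 ≤ Q := (sq_nonneg _).trans b0
  set q4 := 3125 + (σ ^ 3 / 5) ^ 2 * b4 with hq4
  have hq4p : 3125 ≤ q4 := by
    have : 0 ≤ (σ ^ 3 / 5) ^ 2 * b4 := by positivity
    linarith
  have hq0 : q4 ≠ 0 := by linarith
  set e := 3125 / q4 with he
  have he0 : 0 ≤ e := by positivity
  have he1 : e ≤ 1 := by rw [he, div_le_one (by linarith)]; exact hq4p
  have hee : e * q4 = 3125 := by rw [he]; field_simp
  -- remainder
  have hd4 : σ ^ 15 * d4 = -d1 + σ ^ 2 * (e * (σ ^ 4 * (b4 / 78125) * d1 - (a3 / 625) * v3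
      - σ ^ 2 * (a2 / 125) * v2 - σ ^ 4 * (a1 / 25) * d1 - σ * (a0 / 5) * d0)) := by
    have h5 : σ ^ 15 * d4 = e * ((σ ^ 3 / 5) ^ 5 * q4 * d4) := by
      linear_combination (-(σ ^ 15 * d4 / 3125)) * hee
    have hx : e * ((σ ^ 3 / 5) ^ 2 * b4) = 3125 - 3125 * e := by
      linear_combination hee - e * hq4
    rw [h5, hv2, hv3]
    linear_combination e * ode - d1 / 3125 * hx
  have pw : ∀ k : ℕ, k ≤ 4 → σ ^ k ≤ S ^ 4 := fun k hk =>
    (pow_le_pow_left₀ hσ.le hσS k).trans (pow_le_pow_right₀ hS hk)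
  have term : ∀ (k : ℕ) (c a v : ℝ), k ≤ 4 → 1 ≤ c → |a| ≤ M → v ^ 2 ≤ Q →
      |e * (σ ^ k * (a / c) * v) * v3| ≤ M * S ^ 4 * Q := by
    intro k c a v hk hc ha hv
    have hcp : 0 < c := by linarith
    have f1 : |v * v3| ≤ Q := abs_mul_le_Q hv b3
    have f2 : |a / c| ≤ M := by
      rw [abs_div, abs_of_pos hcp]
      exact (div_le_self (abs_nonneg _) hc).trans ha
    have : e * (σ ^ k * (a / c) * v) * v3 = e * (σ ^ k * (a / c)) * (v * v3) := by ring
    rw [this, abs_mul, abs_mul, abs_mul, abs_of_nonneg he0, abs_of_nonneg (by positivity : 0 ≤ σ ^ k)]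
    have := pw k hk
    calc _ ≤ 1 * (S ^ 4 * M) * Q := by gcongr
      _ = _ := by ring
  have t1 := abs_le.1 (term 4 78125 b4 d1 le_rfl (by norm_num) h4 b1)
  have t2 := abs_le.1 (term 0 625 a3 v3 (by norm_num) (by norm_num) h3 b3)
  have t3 := abs_le.1 (term 2 125 a2 v2 (by norm_num) (by norm_num) h2 b2)
  have t4 := abs_le.1 (term 4 25 a1 d1 le_rfl (by norm_num) h1 b1)
  have t5 := abs_le.1 (term 1 5 a0 d0 (by norm_num) (by norm_num) h0 b0)
  have t6 : σ ^ 3 * (d0 * d1) ≤ S ^ 3 * Q := by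
    have := (le_abs_self _).trans (abs_mul_le_Q b0 b1)
    calc _ ≤ σ ^ 3 * Q := by gcongr
      _ ≤ _ := by gcongr
  set R := e * (σ ^ 4 * (b4 / 78125) * d1 - (a3 / 625) * v3
      - σ ^ 2 * (a2 / 125) * v2 - σ ^ 4 * (a1 / 25) * d1 - σ * (a0 / 5) * d0) with hR
  have hRv : R * v3 ≤ 5 * (M * S ^ 4) * Q := by
    have : R * v3 = e * (σ ^ 4 * (b4 / 78125) * d1) * v3 - e * (σ ^ 0 * (a3 / 625) * v3) * v3
      - e * (σ ^ 2 * (a2 / 125) * v2) * v3 - e * (σ ^ 4 * (a1 / 25) * d1) * v3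
      - e * (σ ^ 1 * (a0 / 5) * d0) * v3 := by rw [hR]; ring
    rw [this]
    linarith [t1.1, t1.2, t2.1, t2.2, t3.1, t3.2, t4.1, t4.2, t5.1, t5.2]
  have id1 : σ ^ 3 * (6 / 5 * σ ^ 2 * (d0 * d1 + d1 * d2 + σ ^ 10 * (d2 * d3) + σ ^ 20 * (d3 * d4))
      + 10 * σ ^ 9 * d2 ^ 2 + 20 * σ ^ 19 * d3 ^ 2) =
      6 / 5 * (d1 * v2 + v2 * v3 - d1 * v3) +
      σ ^ 2 * (6 / 5 * (σ ^ 3 * (d0 * d1) + R * v3) + 10 * v2 ^ 2 + 20 * v3 ^ 2) := by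
    have : σ ^ 15 * d4 * v3 = (-d1 + σ ^ 2 * R) * v3 := by rw [hd4]
    rw [hv3] at this
    rw [hv2, hv3]
    linear_combination 6 / 5 * this
  rw [id1]
  have l1 : 6 / 5 * (d1 * v2 + v2 * v3 - d1 * v3) ≤ 3 / 5 * Q := by
    rw [hQ']
    have z1 := sq_nonneg (d1 - v2 + v3)
    have z2 := sq_nonneg d0
    have z3 : (d1 - v2 + v3) ^ 2 = d1 ^ 2 + v2 ^ 2 + v3 ^ 2
      - 2 * (d1 * v2 + v2 * v3 - d1 * v3) := by ring
    linarith only [z1, z2, z3]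
  have l2 : 6 / 5 * (σ ^ 3 * (d0 * d1) + R * v3) + 10 * v2 ^ 2 + 20 * v3 ^ 2 ≤
      (6 / 5 * (S ^ 3 + 5 * (M * S ^ 4)) + 30) * Q := by
    have hz : (6 / 5 * (S ^ 3 + 5 * (M * S ^ 4)) + 30) * Q = 6 / 5 * (S ^ 3 * Q)
      + 6 / 5 * (5 * (M * S ^ 4) * Q) + 10 * Q + 20 * Q := by ring
    rw [hz]
    clear_value Q R e q4
    linarith only [t6, hRv, b2, b3]
  have l3 := mul_le_mul_of_nonneg_left l2 (sq_nonneg σ)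
  rw [add_mul, mul_assoc (σ ^ 2)]
  exact add_le_add l1 l3

lemma uniq (d : ℕ → ℝ → ℝ) (hd : ∀ j s, HasDerivAt (d j) (d (j + 1) s) s)
    (a0 a1 a2 a3 b4 : ℝ → ℝ) (c0 : Continuous a0) (c1 : Continuous a1) (c2 : Continuous a2)
    (c3 : Continuous a3) (c4 : Continuous b4) (hb : ∀ s, 0 ≤ s → 0 ≤ b4 s)
    (ode : ∀ s, s ^ 5 * (3125 + s ^ 2 * b4 s) * d 4 s + s ^ 4 * a3 s * d 3 s + s ^ 3 * a2 s * d 2 s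
      + (1 + s ^ 2 * a1 s) * d 1 s + s * a0 s * d 0 s = 0)
    (C : ℝ) (hC : ∀ n : ℕ, 2 ≤ n → Qe d ((√(10 * n))⁻¹) ≤ C * (10 * n) ^ 5 * Real.exp (-(4 * n)))
    (S : ℝ) (hS : 1 ≤ S) : ∀ σ, 0 < σ → σ ≤ S → Qe d σ = 0 := by
  have bd : ∀ a : ℝ → ℝ, Continuous a → ∃ M, ∀ s ∈ Icc 0 (S ^ 3 / 5), |a s| ≤ M := fun a ha =>
    isCompact_Icc.exists_bound_of_continuousOn ha.continuousOn
  obtain ⟨M0, m0⟩ := bd a0 c0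
  obtain ⟨M1, m1⟩ := bd a1 c1
  obtain ⟨M2, m2⟩ := bd a2 c2
  obtain ⟨M3, m3⟩ := bd a3 c3
  obtain ⟨M4, m4⟩ := bd b4 c4
  set M := max M0 (max M1 (max M2 (max M3 M4))) with hM
  set D := 6 / 5 * (S ^ 3 + 5 * (M * S ^ 4)) + 30 with hD
  set K := 5 / 2 * D ^ 2 * S with hK
  have hK0 : 0 ≤ K := by positivity
  have hQ0 : ∀ σ, 0 < σ → 0 ≤ Qe d σ := fun σ hσ => by unfold Qe; positivity
  have key : ∀ σ, 0 < σ → σ ≤ S → Qd d σ ≤ (7 / 10 * (σ ^ 3)⁻¹ + K) * Qe d σ := by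
    intro σ hσ hσS
    have hs : σ ^ 3 / 5 ∈ Icc 0 (S ^ 3 / 5) := ⟨by positivity, by gcongr⟩
    have := energy_alg M S σ (d 0 (σ ^ 3 / 5)) (d 1 (σ ^ 3 / 5)) (d 2 (σ ^ 3 / 5)) (d 3 (σ ^ 3 / 5))
      (d 4 (σ ^ 3 / 5)) (a0 (σ ^ 3 / 5)) (a1 (σ ^ 3 / 5)) (a2 (σ ^ 3 / 5)) (a3 (σ ^ 3 / 5))
      (b4 (σ ^ 3 / 5)) hσ hσS hS ((m0 _ hs).trans (by simp [hM])) ((m1 _ hs).trans (by simp [hM]))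
      ((m2 _ hs).trans (by simp [hM])) ((m3 _ hs).trans (by simp [hM]))
      ((m4 _ hs).trans (by simp [hM])) (hb _ hs.1) (ode _)
    rw [← hD] at this
    change σ ^ 3 * Qd d σ ≤ (3 / 5 + σ ^ 2 * D) * Qe d σ at this
    have h3 : 0 < σ ^ 3 := by positivity
    have h4 : 3 / 5 + σ ^ 2 * D ≤ 7 / 10 + K * σ ^ 3 := by
      have e1 : K * σ ^ 3 = 5 / 2 * D ^ 2 * σ ^ 3 * S := by rw [hK]; ring
      have e2 : 5 / 2 * D ^ 2 * σ ^ 3 * σ ≤ 5 / 2 * D ^ 2 * σ ^ 3 * S := by gcongr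
      nlinarith [sq_nonneg (σ ^ 2 * D - 1 / 5)]
    have h5 := this.trans (mul_le_mul_of_nonneg_right h4 (hQ0 σ hσ))
    refine le_of_mul_le_mul_left (h5.trans (le_of_eq ?_)) h3
    field_simp
  set Φ : ℝ → ℝ := fun σ => Qe d σ * Real.exp (7 / 20 * (σ ^ 2)⁻¹ - K * σ) with hΦ
  have hder : ∀ σ, 0 < σ → HasDerivAt Φ ((Qd d σ - (7 / 10 * (σ ^ 3)⁻¹ + K) * Qe d σ) *
      Real.exp (7 / 20 * (σ ^ 2)⁻¹ - K * σ)) σ := by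
    intro σ hσ
    have h1 : HasDerivAt (fun σ : ℝ => 7 / 20 * (σ ^ 2)⁻¹ - K * σ) (-(7 / 10 * (σ ^ 3)⁻¹) - K) σ := by
      have := (((hasDerivAt_pow 2 σ).fun_inv (by positivity)).const_mul (7 / 20)).fun_sub
        ((hasDerivAt_id' σ).const_mul K)
      refine this.congr_deriv ?_
      norm_num
      field_simp
      norm_num
    refine ((hasDerivAt_Qe d hd σ).fun_mul h1.exp).congr_deriv ?_
    ring
  have hanti : AntitoneOn Φ (Ioc 0 S) := by
    refine antitoneOn_of_deriv_nonpos (convex_Ioc 0 S)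
      (fun σ hσ => (hder σ hσ.1).continuousAt.continuousWithinAt) ?_ ?_
    · rw [interior_Ioc]
      exact fun σ hσ => (hder σ hσ.1).differentiableAt.differentiableWithinAt
    · rw [interior_Ioc]
      intro σ hσ
      rw [(hder σ hσ.1).deriv]
      refine mul_nonpos_of_nonpos_of_nonneg ?_ (Real.exp_pos _).le
      linarith [key σ hσ.1 hσ.2.le]
  intro σ hσ hσS
  have hlim : Tendsto (fun n : ℕ => C * 20 ^ 5 * (((n : ℝ) / 2) ^ 5 * Real.exp (-((n : ℝ) / 2)))) atTop
      (𝓝 (C * 20 ^ 5 * 0)) := by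
    refine Tendsto.const_mul _ ?_
    exact (Real.tendsto_pow_mul_exp_neg_atTop_nhds_zero 5).comp
      (tendsto_natCast_atTop_atTop.atTop_div_const (by norm_num))
  rw [mul_zero] at hlim
  have hsmall : ∀ᶠ n : ℕ in atTop, (√(10 * n))⁻¹ ≤ σ := by
    have : Tendsto (fun n : ℕ => (√(10 * n))⁻¹) atTop (𝓝 0) :=
      (Real.tendsto_sqrt_atTop.comp
        (tendsto_natCast_atTop_atTop.const_mul_atTop (by norm_num))).inv_tendsto_atTop
    exact (this.eventually (gt_mem_nhds hσ)).mono fun n hn => le_of_lt hn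
  have hle : Φ σ ≤ 0 := by
    refine ge_of_tendsto hlim ?_
    filter_upwards [hsmall, eventually_ge_atTop 2] with n hn hn1
    have hnp : (0:ℝ) < 10 * n := by
      have : (2:ℝ) ≤ n := by exact_mod_cast hn1
      linarith
    have hτ : 0 < (√(10 * n : ℝ))⁻¹ := by positivity
    refine (hanti ⟨hτ, hn.trans hσS⟩ ⟨hσ, hσS⟩ hn).trans ?_
    simp only [hΦ]
    have e1 : ((√(10 * n : ℝ))⁻¹ ^ 2)⁻¹ = 10 * n := by
      rw [inv_pow, inv_inv, Real.sq_sqrt hnp.le]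
    rw [e1]
    have e2 : Real.exp (7 / 20 * (10 * n) - K * (√(10 * n : ℝ))⁻¹) ≤ Real.exp (7 / 2 * n) := by
      apply Real.exp_le_exp.2
      have : 0 ≤ K * (√(10 * n : ℝ))⁻¹ := by positivity
      linarith
    have hQn := hC n hn1
    calc _ ≤ (C * (10 * n) ^ 5 * Real.exp (-(4 * n))) * Real.exp (7 / 2 * n) :=
          mul_le_mul hQn e2 (Real.exp_pos _).le ((hQ0 _ hτ).trans hQn)
      _ = C * (10 * n) ^ 5 * (Real.exp (-(4 * n)) * Real.exp (7 / 2 * n)) := by ring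
      _ = C * (10 * n) ^ 5 * Real.exp (-((n : ℝ) / 2)) := by
          rw [← Real.exp_add]; congr 2; ring
      _ = _ := by ring
  have hpos := hQ0 σ hσ
  refine le_antisymm ?_ hpos
  by_contra hlt
  push Not at hlt
  have : 0 < Φ σ := mul_pos hlt (Real.exp_pos _)
  linarith

lemma stein_cont (f : ℝ → ℝ) (hf : memFH5 f) : Continuous (steinH5 f) := by
  obtain ⟨hc, hi⟩ := hf
  have hct : ∀ t ≤ 13, Continuous (iteratedDeriv t f) := fun t ht =>
    hc.continuous_iteratedDeriv t (by exact_mod_cast ht)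
  have : steinH5 f = fun y => y * f y +
    ∑ t ∈ Finset.range 14, ∑ j ∈ Finset.range 5, cH t j * (y ^ j * iteratedDeriv t f y) :=
    funext (stein_eq f)
  rw [this]
  have := hc.continuous
  refine (continuous_id.mul this).add (continuous_finsetSum _ fun t ht => 
    continuous_finsetSum _ fun j _ => ?_)
  have := hct t (by simp at ht; omega)
  fun_prop

lemma sin_zero_of_symm {μ : Measure ℝ} (h : Measure.map (fun y => -y) μ = μ) (s : ℝ) :
    ∫ y, Real.sin (s * y) ∂μ = 0 := by
  have h1 : ∫ y, Real.sin (s * y) ∂μ = ∫ y, Real.sin (s * (-y)) ∂μ := by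
    conv_lhs => rw [← h]
    rw [integral_map (by fun_prop) (Continuous.aestronglyMeasurable (by fun_prop))]
  have h2 : ∫ y, Real.sin (s * (-y)) ∂μ = - ∫ y, Real.sin (s * y) ∂μ := by
    rw [← integral_neg]; congr 1; funext y; rw [mul_neg, Real.sin_neg]
  linarith

lemma charFun_of_symm {μ : Measure ℝ} [IsProbabilityMeasure μ]
    (h : Measure.map (fun y => -y) μ = μ) (s : ℝ) :
    charFun μ s = ((∫ y, Real.cos (s * y) ∂μ : ℝ) : ℂ) := by
  rw [charFun_apply_real]
  have hc : Integrable (fun y => Real.cos (s * y)) μ :=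
    Integrable.mono' (integrable_const 1) (Continuous.aestronglyMeasurable (by fun_prop))
      (ae_of_all _ fun y => Real.abs_cos_le_one _)
  have hs : Integrable (fun y => Real.sin (s * y)) μ :=
    Integrable.mono' (integrable_const 1) (Continuous.aestronglyMeasurable (by fun_prop))
      (ae_of_all _ fun y => Real.abs_sin_le_one _)
  have e : ∀ y : ℝ, Complex.exp ((s : ℂ) * (y : ℂ) * Complex.I) =
      ((Real.cos (s * y) : ℝ) : ℂ) + ((Real.sin (s * y) : ℝ) : ℂ) * Complex.I := by
    intro y
    rw [Complex.exp_mul_I]; push_cast; rfl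
  simp_rw [e]
  rw [integral_add hc.ofReal (hs.ofReal.mul_const _), integral_mul_const,
    integral_complex_ofReal, integral_complex_ofReal, sin_zero_of_symm h]
  simp

lemma B_bound (C : ℝ) (hC0 : 0 ≤ C) (n : ℕ) (hn : 1 ≤ n) (σ : ℝ) (hσ : 0 < σ)
    (hσn : σ ^ 2 * (10 * n) = 1) :
    2 * (C * ((100 / 9 * n : ℝ) ^ (5 * n) * Real.exp (-(5 * n)))) *
      ((σ ^ 3 / 5) ^ (2 * n) / ((2 * n).factorial : ℝ)) ≤ 2 * C * Real.exp (-(2 * n)) := by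
  have hnp : (0:ℝ) < n := by exact_mod_cast hn
  have hs : σ ^ 3 / 5 = (2 * n) * σ ^ 5 := by linear_combination (-(σ ^ 3) / 5) * hσn
  have hf := Real.pow_div_factorial_le_exp (x := 2 * n) (by positivity) (2 * n)
  have h1 : (σ ^ 3 / 5) ^ (2 * n) / ((2 * n).factorial : ℝ) ≤
      Real.exp (2 * n) * (σ ^ 5) ^ (2 * n) := by
    rw [hs, mul_pow, mul_div_right_comm]
    gcongr
  have h2 : (100 / 9 * n : ℝ) ^ (5 * n) * (σ ^ 5) ^ (2 * n) = ((10 / 9) ^ 5) ^ n := by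
    have : (100 / 9 * n : ℝ) ^ (5 * n) * (σ ^ 5) ^ (2 * n) =
      ((100 / 9 * n * σ ^ 2) ^ 5) ^ n := by
      rw [← pow_mul, ← pow_mul, mul_pow _ (σ ^ 2), ← pow_mul]
      congr 2; ring
    rw [this]
    congr 2
    linear_combination (10 / 9) * hσn
  have h3 : (((10:ℝ) / 9) ^ 5) ^ n ≤ Real.exp n := by
    have : Real.exp n = Real.exp 1 ^ n := by rw [← Real.exp_nat_mul, mul_one]
    rw [this]
    gcongr
    have := Real.add_one_le_exp 1
    norm_num at this ⊢
    linarith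
  calc _ ≤ 2 * (C * ((100 / 9 * n : ℝ) ^ (5 * n) * Real.exp (-(5 * n)))) *
        (Real.exp (2 * n) * (σ ^ 5) ^ (2 * n)) := by gcongr
    _ = 2 * C * (((100 / 9 * n : ℝ) ^ (5 * n) * (σ ^ 5) ^ (2 * n)) *
        (Real.exp (-(5 * n)) * Real.exp (2 * n))) := by ring
    _ ≤ 2 * C * (Real.exp n * (Real.exp (-(5 * n)) * Real.exp (2 * n))) := by
        rw [h2]; gcongr
    _ = _ := by
        rw [← Real.exp_add, ← Real.exp_add]; congr 2; ring

lemma d_bound (d : ℕ → ℝ → ℝ) (hd : ∀ j s, HasDerivAt (d j) (d (j + 1) s) s)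
    (h0 : ∀ j, d j 0 = 0) (n : ℕ) (hn : 2 ≤ n) (M : ℝ) (hM : ∀ s, |d (2 * n) s| ≤ M)
    (σ : ℝ) (hσ : 0 < σ) (hσn : σ ^ 2 * (10 * n) = 1) (j : ℕ) (hj : j ≤ 3) :
    (σ ^ (5 * j) * d j (σ ^ 3 / 5)) ^ 2 ≤
      (M * ((σ ^ 3 / 5) ^ (2 * n) / ((2 * n).factorial : ℝ))) ^ 2 := by
  have hM0 : 0 ≤ M := (abs_nonneg _).trans (hM 0)
  have hs : σ ^ 3 / 5 = (2 * n) * σ ^ 5 := by linear_combination (-(σ ^ 3) / 5) * hσn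
  have h := descend d hd h0 (2 * n) M hM (2 * n - j) (by omega) (σ ^ 3 / 5) (by positivity)
  have e : 2 * n - (2 * n - j) = j := by omega
  rw [e] at h
  rw [sq_le_sq, abs_mul, abs_of_nonneg (by positivity : 0 ≤ σ ^ (5 * j))]
  rw [abs_of_nonneg (by positivity : 0 ≤ M * ((σ ^ 3 / 5) ^ (2 * n) / ((2 * n).factorial : ℝ)))]
  refine (mul_le_mul_of_nonneg_left h (by positivity)).trans ?_
  rw [mul_left_comm]
  refine mul_le_mul_of_nonneg_left ?_ hM0
  rw [← mul_div_assoc, div_le_div_iff₀ (by positivity) (by positivity)]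
  have hfac : ((2 * n).factorial : ℝ) ≤ (2 * n) ^ j * ((2 * n - j).factorial : ℝ) := by
    rw [← Nat.factorial_mul_descFactorial (by omega : j ≤ 2 * n), mul_comm]
    have := Nat.mul_le_mul_right (2 * n - j).factorial (Nat.descFactorial_le_pow (2 * n) j)
    exact_mod_cast this
  have hsp : (σ ^ 3 / 5) ^ (2 * n) = (σ ^ 3 / 5) ^ (2 * n - j) * ((2 * n) ^ j * σ ^ (5 * j)) := by
    rw [pow_mul σ, ← mul_pow, ← hs, ← pow_add]; congr 1; omega
  rw [hsp]
  calc _ ≤ σ ^ (5 * j) * (σ ^ 3 / 5) ^ (2 * n - j) *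
        ((2 * n) ^ j * ((2 * n - j).factorial : ℝ)) := by gcongr
    _ = _ := by ring

lemma Qe_bound (d : ℕ → ℝ → ℝ) (hd : ∀ j s, HasDerivAt (d j) (d (j + 1) s) s)
    (h0 : ∀ j, d j 0 = 0) (C : ℝ) (hC0 : 0 ≤ C)
    (hM : ∀ (n : ℕ) s, |d (2 * n) s| ≤
      2 * (C * ((100 / 9 * n : ℝ) ^ (5 * n) * Real.exp (-(5 * n))))) (n : ℕ) (hn : 2 ≤ n) :
    Qe d ((√(10 * n))⁻¹) ≤ (16 * C ^ 2) * (10 * n) ^ 5 * Real.exp (-(4 * n)) := by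
  have hn2 : (2:ℝ) ≤ n := by exact_mod_cast hn
  have hnp : (0:ℝ) < 10 * n := by linarith
  obtain ⟨σ, hσd⟩ : ∃ σ, σ = (√(10 * n : ℝ))⁻¹ := ⟨_, rfl⟩
  rw [← hσd]
  have hσ : 0 < σ := by rw [hσd]; positivity
  have hσn : σ ^ 2 * (10 * n) = 1 := by
    rw [hσd, inv_pow, Real.sq_sqrt hnp.le]; field_simp
  have hσ1 : σ ^ 10 ≤ 1 := by
    have : σ ^ 2 ≤ 1 := by nlinarith [sq_nonneg σ]
    calc σ ^ 10 = (σ ^ 2) ^ 5 := by ring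
      _ ≤ 1 := pow_le_one₀ (by positivity) this
  set B := 2 * (C * ((100 / 9 * n : ℝ) ^ (5 * n) * Real.exp (-(5 * n)))) *
      ((σ ^ 3 / 5) ^ (2 * n) / ((2 * n).factorial : ℝ)) with hB
  have hB0 : 0 ≤ B := by positivity
  have hBB : B ≤ 2 * C * Real.exp (-(2 * n)) := B_bound C hC0 n (by omega) σ hσ hσn
  have hdj := d_bound d hd h0 n hn _ (hM n) σ hσ hσn
  rw [← hB] at hdj
  have k0 := hdj 0 (by norm_num)
  have k1 := hdj 1 (by norm_num)
  have k2 := hdj 2 (by norm_num)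
  have k3 := hdj 3 (by norm_num)
  norm_num at k0 k1 k2 k3
  have k0' : σ ^ 10 * d 0 (σ ^ 3 / 5) ^ 2 ≤ B ^ 2 :=
    (mul_le_of_le_one_left (sq_nonneg _) hσ1).trans k0
  have hq : σ ^ 10 * Qe d σ ≤ 4 * B ^ 2 := by
    have : σ ^ 10 * Qe d σ = σ ^ 10 * d 0 (σ ^ 3 / 5) ^ 2 + (σ ^ 5 * d 1 (σ ^ 3 / 5)) ^ 2
      + (σ ^ 10 * d 2 (σ ^ 3 / 5)) ^ 2 + (σ ^ 15 * d 3 (σ ^ 3 / 5)) ^ 2 := by unfold Qe; ring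
    rw [this]
    linarith only [k0', k1, k2, k3]
  have hB2 : B ^ 2 ≤ 4 * C ^ 2 * Real.exp (-(4 * n)) := by
    calc B ^ 2 ≤ (2 * C * Real.exp (-(2 * n))) ^ 2 := by gcongr
      _ = 4 * C ^ 2 * (Real.exp (-(2 * n)) * Real.exp (-(2 * n))) := by ring
      _ = _ := by rw [← Real.exp_add]; congr 2; ring
  have e1 : Qe d σ = (10 * n) ^ 5 * (σ ^ 10 * Qe d σ) := by
    have : (10 * n : ℝ) ^ 5 * σ ^ 10 = 1 := by
      rw [show σ ^ 10 = (σ ^ 2) ^ 5 by ring, ← mul_pow, mul_comm, hσn, one_pow]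
    rw [← mul_assoc, this, one_mul]
  rw [e1]
  calc _ ≤ (10 * n : ℝ) ^ 5 * (4 * (4 * C ^ 2 * Real.exp (-(4 * n)))) := 
        mul_le_mul_of_nonneg_left (by linarith only [hq, hB2]) (by positivity)
    _ = _ := by ring

lemma stein_bwd {μ : Measure ℝ} [IsProbabilityMeasure μ]
    (hsym : Measure.map (fun y => -y) μ = μ)
    (hi4 : Integrable (fun y : ℝ => y ^ 4) μ)
    (hS : ∀ f : ℝ → ℝ, memFH5 f → ∫ y, steinH5 f y ∂μ = 0) : μ = lawH5 := by
  have hi := moments_all hS hi4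
  have hmom := moments_eq hS stein_fwd hi lawH5_integrable
  obtain ⟨C, hC0, hC⟩ := lawH5_moment_bound
  set d : ℕ → ℝ → ℝ := fun j s => phi μ j s - phi lawH5 j s with hdd
  have hd : ∀ j s, HasDerivAt (d j) (d (j + 1) s) s := fun j s =>
    (hasDerivAt_phi hi j s).sub (hasDerivAt_phi lawH5_integrable j s)
  have h0 : ∀ j, d j 0 = 0 := fun j => by simp only [hdd, phi_zero, hmom, sub_self]
  have hM : ∀ (n : ℕ) s, |d (2 * n) s| ≤
      2 * (C * ((100 / 9 * n : ℝ) ^ (5 * n) * Real.exp (-(5 * n)))) := by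
    intro n s
    have h1 := phi_le hi n s
    have h2 := phi_le lawH5_integrable n s
    rw [hmom] at h1
    have := hC n
    have h3 := abs_sub (phi μ (2 * n) s) (phi lawH5 (2 * n) s)
    simp only [hdd]
    linarith
  have hQ := Qe_bound d hd h0 C hC0 hM
  have hpos : ∀ s, 0 < s → d 0 s = 0 := by
    intro s hs
    obtain ⟨σ, hσ, hσs⟩ : ∃ σ : ℝ, 0 < σ ∧ σ ^ 3 / 5 = s := by
      refine ⟨(5 * s) ^ ((1:ℝ) / 3), by positivity, ?_⟩
      rw [← Real.rpow_natCast, ← Real.rpow_mul (by positivity)]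
      norm_num
    have := uniq d hd q0 q1 q2 q3 r4 (by unfold q0; fun_prop) (by unfold q1; fun_prop)
      (by unfold q2; fun_prop) (by unfold q3; fun_prop) (by unfold r4; fun_prop)
      (fun s hs => by unfold r4; positivity)
      (fun s => by
        have h1 := phi_ode hi hS s
        have h2 := phi_ode lawH5_integrable stein_fwd s
        simp only [hdd]
        linear_combination h1 - h2) _ hQ (max 1 σ) (le_max_left _ _) σ hσ (le_max_right _ _)
    unfold Qe at this
    rw [hσs] at this
    have p1 := sq_nonneg (d 0 s)
    have p2 := sq_nonneg (d 1 s)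
    have p3 : 0 ≤ σ ^ 10 * d 2 s ^ 2 := by positivity
    have p4 : 0 ≤ σ ^ 20 * d 3 s ^ 2 := by positivity
    exact pow_eq_zero_iff (two_ne_zero) |>.1 (by linarith only [this, p1, p2, p3, p4])
  have hcos : ∀ s, 0 < s → ∫ y, Real.cos (s * y) ∂μ = ∫ y, Real.cos (s * y) ∂lawH5 := by
    intro s hs
    have := hpos s hs
    simp only [hdd, phi, pow_zero, one_mul, Nat.cast_zero, zero_mul, add_zero] at this
    linarith
  apply Measure.ext_of_charFun
  funext s
  rw [charFun_of_symm hsym, charFun_of_symm lawH5_symm]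
  congr 1
  rcases lt_trichotomy s 0 with h | h | h
  · have := hcos (-s) (by linarith)
    simpa only [neg_mul, Real.cos_neg] using this
  · subst h; simp
  · exact hcos s h

/-- Stein characterisation of `H₅(X) = X⁵ - 10X³ + 15X`, `X ∼ N(0,1)`,
via the operator `S₅`, among symmetric random variables with finite fourth moment. -/
theorem stein_characterisation_H5
    {Ω : Type*} [MeasurableSpace Ω] (ν : Measure Ω) [IsProbabilityMeasure ν]
    (W : Ω → ℝ) (hW : Measurable W)
    (hWsymm : Measure.map W ν = Measure.map (fun ω => -W ω) ν)
    (hWmom : Integrable (fun ω => (W ω) ^ 4) ν) :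
    Measure.map W ν = lawH5 ↔
      ∀ f : ℝ → ℝ, memFH5 f → ∫ ω, steinH5 f (W ω) ∂ν = 0 := by
  have hae : AEMeasurable W ν := hW.aemeasurable
  have key : ∀ f : ℝ → ℝ, memFH5 f →
      ∫ ω, steinH5 f (W ω) ∂ν = ∫ y, steinH5 f y ∂(Measure.map W ν) := fun f hf =>
    (integral_map hae (stein_cont f hf).aestronglyMeasurable).symm
  constructor
  · intro h f hf
    rw [key f hf, h]
    exact stein_fwd f hf
  · intro h
    have : IsProbabilityMeasure (Measure.map W ν) := Measure.isProbabilityMeasure_map hae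
    refine stein_bwd ?_ ?_ fun f hf => by rw [← key f hf]; exact h f hf
    · rw [Measure.map_map (by fun_prop) hW]
      exact hWsymm.symm
    · rw [integrable_map_measure (Continuous.aestronglyMeasurable (by fun_prop)) hae]
      exact hWmom
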